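/- Let 0 < a < 1 and β > 0 be constants, and set p_n = a·log n/n. Then there exist a constant C > 0 and N such that for all n ≥ N, the probability that the size Z_n of a largest connected component of G(n, p_n) satisfies Z_n > n − β·n/log log n is greater than 1 − n^{−C·log n}. -/

import Mathlib

/-!
Erdős–Rényi random graphs `G(n,p)`: each of the `C(n,2)` unordered pairs of
distinct vertices is an edge independently with probability `p`.
-/

open scoped BigOperators

namespace ErdosRenyi

/-- Ordered pairs of distinct vertices `{(i,j) : i < j}`. -/
abbrev EPair (n : ℕ) := {e : Fin n × Fin n // e.1 < e.2}

/-- A configuration records, for each pair, whether the edge is present. -/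
abbrev EConfig (n : ℕ) := EPair n → Bool

/-- The probability of a given configuration in `G(n,p)`. -/
noncomputable def erWeight (n : ℕ) (p : ℝ) (ω : EConfig n) : ℝ :=
  ∏ e : EPair n, (if ω e then p else 1 - p)

/-- The probability of a set of configurations in `G(n,p)`. -/
noncomputable def erProb (n : ℕ) (p : ℝ) (S : Set (EConfig n)) : ℝ :=
  ∑ ω : EConfig n, S.indicator (erWeight n p) ω

/-- The simple graph determined by a configuration. -/
def graphOf {n : ℕ} (ω : EConfig n) : SimpleGraph (Fin n) :=
  SimpleGraph.fromRel (fun i j => ∃ h : i < j, ω ⟨(i, j), h⟩ = true)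

/-- The number of vertices of a largest connected component. -/
noncomputable def maxCompSize {n : ℕ} (H : SimpleGraph (Fin n)) : ℕ :=
  Finset.univ.sup (fun v => {w | H.Reachable v w}.ncard)

open Finset in
lemma sum_avoid (n : ℕ) (p : ℝ) (E : Finset (EPair n)) :
    ∑ ω : EConfig n, (if ∀ e ∈ E, ω e = false then erWeight n p ω else 0)
      = (1 - p) ^ E.card := by
  classical
  have h1 : ∀ ω : EConfig n, (if ∀ e ∈ E, ω e = false then erWeight n p ω else 0)
      = ∏ e : EPair n, (if ω e then (if e ∈ E then 0 else p) else 1 - p) := by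
    intro ω
    split_ifs with h
    · unfold erWeight
      refine Finset.prod_congr rfl fun e _ => ?_
      by_cases he : e ∈ E
      · simp [h e he]
      · simp [he]
    · push Not at h
      obtain ⟨e, he, h2⟩ := h
      symm
      apply Finset.prod_eq_zero (Finset.mem_univ e)
      simp at h2
      simp [h2, he]
  rw [Finset.sum_congr rfl fun ω _ => h1 ω]
  have h2 := Fintype.prod_sum (fun (e : EPair n) (b : Bool) =>
    (if b then (if e ∈ E then 0 else p) else 1 - p : ℝ))
  rw [← h2]
  have h3 : ∀ e : EPair n, ∑ b : Bool, (if b then (if e ∈ E then 0 else p) else 1 - p : ℝ)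
      = if e ∈ E then 1 - p else 1 := by
    intro e
    by_cases he : e ∈ E <;> simp [he]
  rw [Finset.prod_congr rfl fun e _ => h3 e]
  simp

lemma sum_weight (n : ℕ) (p : ℝ) : ∑ ω : EConfig n, erWeight n p ω = 1 := by
  have := sum_avoid n p ∅
  simpa using this

/-- Pairs crossing the cut `A`. -/
def cutE (n : ℕ) (A : Finset (Fin n)) : Finset (EPair n) :=
  Finset.univ.filter fun e => ¬ (e.1.1 ∈ A ↔ e.1.2 ∈ A)

lemma card_cut (n : ℕ) (A : Finset (Fin n)) : A.card * (n - A.card) ≤ (cutE n A).card := by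
  classical
  have h0 : A.card * (n - A.card) = (A ×ˢ Aᶜ).card := by
    rw [Finset.card_product, Finset.card_compl, Fintype.card_fin]
  rw [h0]
  have hne : ∀ q ∈ A ×ˢ Aᶜ, q.1 ≠ q.2 := by
    rintro ⟨u, v⟩ hq h
    simp at hq h
    subst h
    exact hq.2 hq.1
  refine Finset.card_le_card_of_forall_subsingleton
    (fun q e => (e.1 = (q.1, q.2) ∨ e.1 = (q.2, q.1))) ?_ ?_
  · rintro ⟨u, v⟩ hq
    have h1 := hne _ hq
    simp at hq h1
    rcases lt_or_gt_of_ne h1 with h | h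
    · exact ⟨⟨(u, v), h⟩, by simp [cutE, hq], Or.inl rfl⟩
    · exact ⟨⟨(v, u), h⟩, by simp [cutE, hq], Or.inr rfl⟩
  · rintro ⟨⟨x, y⟩, hxy⟩ he ⟨u, v⟩ ⟨hq, h⟩ ⟨u', v'⟩ ⟨hq', h'⟩
    simp at hq hq' h h' ⊢
    grind

lemma comb (n : ℕ) (H : SimpleGraph (Fin n)) (t : ℝ) (ht : 0 < t) (h3 : 3 * t ≤ n)
    (hM : (maxCompSize H : ℝ) ≤ n - 2 * t) :
    ∃ A : Finset (Fin n), t ≤ A.card ∧ (A.card : ℝ) ≤ n - t ∧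
      ∀ u w, H.Adj u w → u ∈ A → w ∈ A := by
  classical
  let F : Finset (Finset (Fin n)) := Finset.univ.filter fun A =>
    t ≤ A.card ∧ ∀ u w, H.Adj u w → u ∈ A → w ∈ A
  have hF : F.Nonempty := ⟨Finset.univ, by simp [F]; linarith⟩
  obtain ⟨A, hA, hmin⟩ := Finset.exists_min_image F Finset.card hF
  simp only [F, Finset.mem_filter, Finset.mem_univ, true_and] at hA hmin
  have hne : A.Nonempty := by
    rw [← Finset.card_pos]
    have := hA.1
    have : (0 : ℝ) < A.card := by linarith
    exact_mod_cast this
  obtain ⟨v, hv⟩ := hne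
  let K : Finset (Fin n) := Finset.univ.filter fun w => H.Reachable v w
  have hKc : (K.card : ℝ) ≤ maxCompSize H := by
    have h1 : ({w | H.Reachable v w} : Set (Fin n)).ncard = K.card := by
      rw [← Set.ncard_coe_finset]; congr; ext; simp [K]
    have : K.card ≤ maxCompSize H := by
      rw [← h1]
      exact Finset.le_sup (f := fun v => ({w | H.Reachable v w} : Set (Fin n)).ncard)
        (Finset.mem_univ v)
    exact_mod_cast this
  have hKcl : ∀ u w, H.Adj u w → u ∈ K → w ∈ K := by
    intro u w huw hu
    simp only [K, Finset.mem_filter, Finset.mem_univ, true_and] at hu ⊢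
    exact hu.trans huw.reachable
  have hvK : v ∈ K := by simp [K]
  by_cases hK : t ≤ K.card
  · exact ⟨K, hK, by linarith, hKcl⟩
  · refine ⟨A, hA.1, ?_, hA.2⟩
    have h1 : ((A \ K).card : ℝ) < t := by
      by_contra hcon
      push Not at hcon
      have := hmin (A \ K) ⟨hcon, by
        intro u w huw hu
        simp only [Finset.mem_sdiff] at hu ⊢
        exact ⟨hA.2 u w huw hu.1, fun hw => hu.2 (hKcl w u huw.symm hw)⟩⟩
      have h2 : (A \ K).card < A.card := by
        apply Finset.card_lt_card
        refine ⟨Finset.sdiff_subset, fun hs => ?_⟩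
        have := hs hv
        simp [hvK] at this
      omega
    have h2 : (A.card : ℝ) ≤ (A \ K).card + K.card := by
      have : A.card ≤ (A \ K).card + K.card := by
        have := Finset.le_card_sdiff K A
        omega
      exact_mod_cast this
    push Not at hK
    linarith

lemma closed_cut {n : ℕ} (ω : EConfig n) (A : Finset (Fin n))
    (h : ∀ u w, (graphOf ω).Adj u w → u ∈ A → w ∈ A) :
    ∀ e ∈ cutE n A, ω e = false := by
  rintro ⟨⟨x, y⟩, hxy⟩ he
  by_contra hc
  simp only [Bool.not_eq_false] at hc
  have hadj : (graphOf ω).Adj x y := by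
    unfold graphOf
    rw [SimpleGraph.fromRel_adj]
    exact ⟨ne_of_lt hxy, Or.inl ⟨hxy, hc⟩⟩
  simp only [cutE, Finset.mem_filter, Finset.mem_univ, true_and] at he
  exact he ⟨h _ _ hadj, h _ _ hadj.symm⟩

lemma weight_nonneg (n : ℕ) (p : ℝ) (h0 : 0 ≤ p) (h1 : p ≤ 1) (ω : EConfig n) :
    0 ≤ erWeight n p ω := by
  unfold erWeight
  refine Finset.prod_nonneg fun e _ => ?_
  split_ifs <;> linarith

lemma prob_bound (n : ℕ) (p t : ℝ) (h0 : 0 ≤ p) (h1 : p ≤ 1) (ht : 0 < t) (h3 : 3 * t ≤ n) :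
    1 - 2 ^ n * Real.exp (-(p * (t * (n - t)))) ≤
      erProb n p {ω | (n : ℝ) - 2 * t < (maxCompSize (graphOf ω) : ℝ)} := by
  classical
  let G : Finset (Finset (Fin n)) := Finset.univ.filter fun A =>
    t ≤ A.card ∧ (A.card : ℝ) ≤ n - t
  have key : ∀ ω : EConfig n, erWeight n p ω ≤
      ({ω | (n : ℝ) - 2 * t < (maxCompSize (graphOf ω) : ℝ)} : Set (EConfig n)).indicator
        (erWeight n p) ω
      + ∑ A ∈ G, (if ∀ e ∈ cutE n A, ω e = false then erWeight n p ω else 0) := by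
    intro ω
    have hw := weight_nonneg n p h0 h1 ω
    have hs : ∀ A ∈ G, 0 ≤ (if ∀ e ∈ cutE n A, ω e = false then erWeight n p ω else 0) := by
      intro A _
      split_ifs <;> simp [hw]
    by_cases hω : (n : ℝ) - 2 * t < (maxCompSize (graphOf ω) : ℝ)
    · rw [Set.indicator_of_mem (by exact hω)]
      linarith [Finset.sum_nonneg hs]
    · rw [Set.indicator_of_notMem (by exact hω), zero_add]
      obtain ⟨A, hA1, hA2, hA3⟩ := comb n (graphOf ω) t ht h3 (not_lt.mp hω)
      have hAG : A ∈ G := by simp [G, hA1, hA2]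
      refine le_trans ?_ (Finset.single_le_sum hs hAG)
      rw [if_pos (closed_cut ω A hA3)]
  have hsum := Finset.sum_le_sum fun ω (_ : ω ∈ (Finset.univ : Finset (EConfig n))) => key ω
  rw [sum_weight, Finset.sum_add_distrib, Finset.sum_comm] at hsum
  have hb : ∑ A ∈ G, ∑ ω : EConfig n,
      (if ∀ e ∈ cutE n A, ω e = false then erWeight n p ω else 0)
      ≤ 2 ^ n * Real.exp (-(p * (t * (n - t)))) := by
    have hG : (G.card : ℝ) ≤ 2 ^ n := by
      have : G.card ≤ 2 ^ n := by
        refine (Finset.card_le_univ G).trans ?_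
        simp
      exact_mod_cast this
    calc _ ≤ ∑ A ∈ G, Real.exp (-(p * (t * (n - t)))) := by
            refine Finset.sum_le_sum fun A hA => ?_
            rw [sum_avoid]
            simp only [G, Finset.mem_filter, Finset.mem_univ, true_and] at hA
            have hle : A.card ≤ n := by simpa using Finset.card_le_univ A
            have hc : (A.card : ℝ) * (n - A.card) ≤ (cutE n A).card := by
              have := card_cut n A
              rw [← Nat.cast_sub hle]
              exact_mod_cast this
            have hc2 : t * (n - t) ≤ (cutE n A).card := by
              nlinarith [mul_nonneg (sub_nonneg.2 hA.1) (sub_nonneg.2 hA.2)]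
            calc (1 - p) ^ (cutE n A).card ≤ (Real.exp (-p)) ^ (cutE n A).card := by
                  apply pow_le_pow_left₀ (by linarith)
                  linarith [Real.add_one_le_exp (-p)]
              _ = Real.exp (-(p * (cutE n A).card)) := by
                  rw [← Real.exp_nat_mul]; congr 1; ring
              _ ≤ _ := by
                  apply Real.exp_le_exp.2
                  have := mul_le_mul_of_nonneg_left hc2 h0
                  linarith
      _ = G.card * Real.exp (-(p * (t * (n - t)))) := by simp
      _ ≤ _ := mul_le_mul_of_nonneg_right hG (Real.exp_pos _).le
  unfold erProb
  linarith

/-- For `0 < a < 1`, `p_n = a·log n/n` and a constant `β > 0`,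
there are `C > 0` and `N` such that for all `n ≥ N` the largest connected component
of `G(n, p_n)` has size greater than `n − β n / log log n` with probability greater
than `1 − n^(−C·log n)`. -/
theorem er_giant_component (a β : ℝ) (ha0 : 0 < a) (ha1 : a < 1) (hβ : 0 < β) :
    ∃ C : ℝ, 0 < C ∧ ∃ N : ℕ, ∀ n : ℕ, N ≤ n →
      1 - (n : ℝ) ^ (-(C * Real.log n)) <
        erProb n (a * Real.log n / n)
          {ω | (n : ℝ) - β * n / Real.log (Real.log n) <
                (maxCompSize (graphOf ω) : ℝ)} := by
  refine ⟨1, one_pos, ?_⟩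
  have hlog : Filter.Tendsto (fun n : ℕ => Real.log n) Filter.atTop Filter.atTop :=
    Real.tendsto_log_atTop.comp tendsto_natCast_atTop_atTop
  have hll : Filter.Tendsto (fun n : ℕ => Real.log (Real.log n)) Filter.atTop Filter.atTop :=
    Real.tendsto_log_atTop.comp hlog
  have e1 : ∀ᶠ n : ℕ in Filter.atTop,
      ‖Real.log (Real.log n)‖ ≤ (a * β / 6) * ‖Real.log n‖ := by
    have := Real.isLittleO_log_id_atTop.bound (show 0 < a * β / 6 by positivity)
    exact hlog.eventually this
  have e2 : ∀ᶠ n : ℕ in Filter.atTop, ‖Real.log (n : ℝ) ^ 2‖ ≤ (1 / 2) * ‖(n : ℝ)‖ := by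
    have := (Real.isLittleO_pow_log_id_atTop (n := 2)).bound (show (0 : ℝ) < 1 / 2 by norm_num)
    exact tendsto_natCast_atTop_atTop.eventually this
  have e3 := hll.eventually_ge_atTop (3 * β / 2)
  have e4 := hlog.eventually_ge_atTop 1
  have e5 := Filter.eventually_ge_atTop (1 : ℕ)
  obtain ⟨N, hN⟩ := Filter.eventually_atTop.1
    (e1.and (e2.and (e3.and (e4.and e5))))
  refine ⟨N, fun n hn => ?_⟩
  obtain ⟨h1, h2, h3, h4, h5⟩ := hN n hn
  have hn0 : (0 : ℝ) < n := by exact_mod_cast h5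
  set L := Real.log (n : ℝ) with hL
  set M := Real.log L with hM
  have hM0 : 0 < M := lt_of_lt_of_le (by positivity) h3
  rw [Real.norm_of_nonneg hM0.le, Real.norm_of_nonneg (by linarith)] at h1
  rw [Real.norm_of_nonneg (by positivity), Real.norm_of_nonneg hn0.le] at h2
  have hLn : L ≤ n := by nlinarith
  have hp0 : 0 ≤ a * L / n := by positivity
  have hp1 : a * L / n ≤ 1 := by
    rw [div_le_one hn0]; nlinarith
  have ht : 0 < β * n / (2 * M) := by positivity
  have ht3 : 3 * (β * n / (2 * M)) ≤ n := by
    rw [← mul_div_assoc, div_le_iff₀ (by positivity)]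
    nlinarith
  have hb := prob_bound n (a * L / n) (β * n / (2 * M)) hp0 hp1 ht ht3
  have h2t : 2 * (β * n / (2 * M)) = β * n / M := by field_simp
  rw [h2t] at hb
  refine lt_of_lt_of_le ?_ hb
  have hexp : 2 * (n : ℝ) ≤ a * L / n * (β * n / (2 * M) * (n - β * n / (2 * M))) := by
    have g1 : (2 / 3 : ℝ) * n ≤ n - β * n / (2 * M) := by linarith
    calc 2 * (n : ℝ) ≤ (a * β * L / (3 * M)) * n := by
          apply mul_le_mul_of_nonneg_right _ hn0.le
          rw [le_div_iff₀ (by positivity)]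
          linarith
      _ = a * L / n * (β * n / (2 * M) * ((2 / 3 : ℝ) * n)) := by
          field_simp
      _ ≤ _ := by gcongr
  have hrp : (n : ℝ) ^ (-(1 * L)) = Real.exp (-(L ^ 2)) := by
    rw [Real.rpow_def_of_pos hn0]; congr 1; rw [← hL]; ring
  rw [hrp]
  have h2n : (2 : ℝ) ^ n ≤ Real.exp n := by
    have : (2 : ℝ) ≤ Real.exp 1 := by linarith [Real.add_one_le_exp (1 : ℝ)]
    calc (2 : ℝ) ^ n ≤ (Real.exp 1) ^ n := pow_le_pow_left₀ (by norm_num) this n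
      _ = Real.exp n := by rw [← Real.exp_nat_mul]; simp
  have hfin : (2 : ℝ) ^ n *
      Real.exp (-(a * L / n * (β * n / (2 * M) * (n - β * n / (2 * M))))) < Real.exp (-(L ^ 2)) := by
    calc _ ≤ Real.exp n * Real.exp (-(2 * n)) := by
          gcongr
      _ = Real.exp (-(n : ℝ)) := by rw [← Real.exp_add]; congr 1; ring
      _ < _ := by
          apply Real.exp_lt_exp.2
          linarith
  linarith

end ErdosRenyi
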